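/- Let 0 < α ≤ 1/2. Then for every 0 < ε ≤ 1, every integer N ≥ 2 and every i with 2 ≤ i ≤ N, the mesh widths of the Liseikin mesh satisfy h_i − h_{i−1} ≤ 2(1−α) κ² h² (x_i + ε^{1/2})^{1−2α}, where κ = ((1+ε^{1/2})^α − ε^{α/2})/α; in particular h_i − h_{i−1} ≤ C h² (x_i + ε^{1/2})^{1−2α} with C depending only on α. -/

import Mathlib

/-- Liseikin's mesh generating function on `[-1,1]`
(extended to all of `ℝ` by the same formulas). -/
noncomputable def liseikinPhi (α ε ξ : ℝ) : ℝ :=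
  if 0 ≤ ξ then
    (ε ^ (α/2) + ξ * ((1 + ε ^ ((1:ℝ)/2)) ^ α - ε ^ (α/2))) ^ (1/α) - ε ^ ((1:ℝ)/2)
  else
    ε ^ ((1:ℝ)/2) - (ε ^ (α/2) + (-ξ) * ((1 + ε ^ ((1:ℝ)/2)) ^ α - ε ^ (α/2))) ^ (1/α)

/-- The mesh points `x_i = φ(i/N, ε)`, `i = -N, …, N`. -/
noncomputable def liseikinX (α ε : ℝ) (N : ℕ) (i : ℤ) : ℝ :=
  liseikinPhi α ε ((i : ℝ) / N)

/-- The mesh widths `h_i = x_i - x_{i-1}`. -/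
noncomputable def liseikinH (α ε : ℝ) (N : ℕ) (i : ℤ) : ℝ :=
  liseikinX α ε N i - liseikinX α ε N (i - 1)

/-- The mean value theorem for `t ↦ t ^ p` on the positive half-line. -/
theorem exists_rpow_sub_rpow_eq {p a b : ℝ} (ha : 0 < a) (hab : a < b) :
    ∃ c ∈ Set.Ioo a b, b ^ p - a ^ p = p * c ^ (p - 1) * (b - a) := by
  have hd : ∀ x, 0 < x → HasDerivAt (fun t : ℝ => t ^ p) (p * x ^ (p - 1)) x :=
    fun x hx => Real.hasDerivAt_rpow_const (Or.inl hx.ne')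
  obtain ⟨c, hc, h⟩ := exists_hasDerivAt_eq_slope (fun t : ℝ => t ^ p)
    (fun x => p * x ^ (p - 1)) hab
    (fun x hx => (hd x (ha.trans_le hx.1)).continuousAt.continuousWithinAt)
    (fun x hx => hd x (ha.trans hx.1))
  refine ⟨c, hc, ?_⟩
  rw [h, div_mul_cancel₀ _ (sub_pos.2 hab).ne']

/-- The backward second difference of `t ↦ t ^ p`, `p ≥ 2`, is controlled by the second
derivative at the right end point. -/
theorem rpow_second_difference_le {p u δ : ℝ} (hp : 2 ≤ p) (hδ : 0 < δ) (hu : 0 < u - 2 * δ) :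
    u ^ p - 2 * (u - δ) ^ p + (u - 2 * δ) ^ p ≤ p * (p - 1) * δ ^ 2 * u ^ (p - 2) := by
  have hd : ∀ x, u - δ ≤ x → HasDerivAt (fun t : ℝ => t ^ p - (t - δ) ^ p)
      (p * x ^ (p - 1) - p * (x - δ) ^ (p - 1)) x := by
    intro x hx
    have h2 := ((hasDerivAt_id x).sub_const δ).rpow_const (p := p)
      (Or.inl (by simp only [id]; linarith))
    simp only [id, one_mul] at h2
    exact (Real.hasDerivAt_rpow_const (Or.inl (by linarith))).sub h2
  obtain ⟨η, hη, h⟩ := exists_hasDerivAt_eq_slope (fun t : ℝ => t ^ p - (t - δ) ^ p)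
    (fun x => p * x ^ (p - 1) - p * (x - δ) ^ (p - 1)) (show u - δ < u by linarith)
    (fun x hx => (hd x hx.1).continuousAt.continuousWithinAt)
    (fun x hx => hd x hx.1.le)
  rw [eq_div_iff (by linarith)] at h
  obtain ⟨ζ, hζ, hz⟩ := exists_rpow_sub_rpow_eq (p := p - 1) (a := η - δ) (b := η)
    (by linarith [hη.1]) (by linarith)
  have hle : ζ ^ (p - 2) ≤ u ^ (p - 2) :=
    Real.rpow_le_rpow (by linarith [hζ.1, hη.1]) (by linarith [hζ.2, hη.2]) (by linarith)
  rw [show p - 1 - 1 = p - 2 by ring] at hz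
  rw [show u - δ - δ = u - 2 * δ by ring] at h
  calc u ^ p - 2 * (u - δ) ^ p + (u - 2 * δ) ^ p
      = p * (η ^ (p - 1) - (η - δ) ^ (p - 1)) * δ := by linear_combination -h
    _ = p * (p - 1) * δ ^ 2 * ζ ^ (p - 2) := by rw [hz]; ring
    _ ≤ _ := mul_le_mul_of_nonneg_left hle
        (mul_nonneg (mul_nonneg (by linarith) (by linarith)) (sq_nonneg _))

theorem liseikin_slope_pos {α ε : ℝ} (hα : 0 < α) (hε : 0 < ε) :
    0 < (1 + ε ^ ((1:ℝ)/2)) ^ α - ε ^ (α/2) := by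
  have h : ε ^ (α/2) = (ε ^ ((1:ℝ)/2)) ^ α := by
    rw [← Real.rpow_mul hε.le]; congr 1; ring
  rw [h, sub_pos]
  exact Real.rpow_lt_rpow (by positivity) (by linarith) hα

theorem liseikinX_of_nonneg (α ε : ℝ) (N : ℕ) {i : ℤ} (hi : 0 ≤ i) :
    liseikinX α ε N i =
      (ε ^ (α/2) + (i : ℝ) / N * ((1 + ε ^ ((1:ℝ)/2)) ^ α - ε ^ (α/2))) ^ (1/α)
        - ε ^ ((1:ℝ)/2) := by
  have h : (0:ℝ) ≤ (i : ℝ) / N := div_nonneg (by exact_mod_cast hi) N.cast_nonneg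
  rw [liseikinX, liseikinPhi, if_pos h]

theorem liseikinH_sub_le {α ε : ℝ} (hα0 : 0 < α) (hα1 : α ≤ 1/2) (hε : 0 < ε) {N : ℕ}
    (hN : 0 < N) {i : ℤ} (hi : 2 ≤ i) :
    liseikinH α ε N i - liseikinH α ε N (i-1)
      ≤ (1 - α) * (((1 + ε ^ ((1:ℝ)/2)) ^ α - ε ^ (α/2)) / α) ^ 2 * ((1:ℝ)/N) ^ 2
          * (liseikinX α ε N i + ε ^ ((1:ℝ)/2)) ^ (1 - 2*α) := by
  have hD := liseikin_slope_pos hα0 hε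
  simp only [liseikinH]
  rw [liseikinX_of_nonneg α ε N (show 0 ≤ i by lia),
    liseikinX_of_nonneg α ε N (show 0 ≤ i - 1 by lia),
    liseikinX_of_nonneg α ε N (show 0 ≤ i - 1 - 1 by lia)]
  set D := (1 + ε ^ ((1:ℝ)/2)) ^ α - ε ^ (α/2)
  have hN' : (0:ℝ) < N := by exact_mod_cast hN
  have hi' : (2:ℝ) ≤ i := by exact_mod_cast hi
  have hc : 0 < ε ^ (α/2) := Real.rpow_pos_of_pos hε _
  push_cast
  set u := ε ^ (α/2) + (i : ℝ) / N * D with hu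
  have e1 : ε ^ (α/2) + ((i : ℝ) - 1) / N * D = u - D / N := by rw [hu]; ring
  have e2 : ε ^ (α/2) + ((i : ℝ) - 1 - 1) / N * D = u - 2 * (D / N) := by rw [hu]; ring
  have hpos : 0 < u - 2 * (D / N) := by
    rw [← e2]
    have : 0 ≤ ((i : ℝ) - 1 - 1) / N * D :=
      mul_nonneg (div_nonneg (by linarith) hN'.le) hD.le
    linarith
  have hδ : 0 < D / N := div_pos hD hN'
  have hpow : (u ^ (1/α) - ε ^ ((1:ℝ)/2) + ε ^ ((1:ℝ)/2)) ^ (1 - 2*α) = u ^ (1/α - 2) := by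
    rw [sub_add_cancel, ← Real.rpow_mul (by linarith)]
    congr 1
    field_simp
  rw [e1, e2, hpow]
  have h := rpow_second_difference_le (p := 1/α) (by rw [le_div_iff₀ hα0]; linarith) hδ hpos
  have hcoef : 1/α * (1/α - 1) * (D / N) ^ 2 = (1 - α) * (D / α) ^ 2 * ((1:ℝ)/N) ^ 2 := by
    field_simp
  rw [hcoef] at h
  linarith

theorem liseikinX_add_nonneg {α ε : ℝ} (hα : 0 < α) (hε : 0 < ε) (N : ℕ) {i : ℤ}
    (hi : 0 ≤ i) : 0 ≤ liseikinX α ε N i + ε ^ ((1:ℝ)/2) := by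
  have hD := liseikin_slope_pos hα hε
  have hi' : (0:ℝ) ≤ i := by exact_mod_cast hi
  rw [liseikinX_of_nonneg α ε N hi, sub_add_cancel]
  positivity

theorem liseikin_hdiff_bound (α : ℝ) (hα0 : 0 < α) (hα1 : α ≤ 1/2) :
    (∀ ε : ℝ, 0 < ε → ε ≤ 1 → ∀ N : ℕ, 2 ≤ N → ∀ i : ℤ, 2 ≤ i → i ≤ N →
      liseikinH α ε N i - liseikinH α ε N (i-1)
        ≤ 2 * (1 - α) * (((1 + ε ^ ((1:ℝ)/2)) ^ α - ε ^ (α/2)) / α) ^ 2 * ((1:ℝ)/N) ^ 2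
            * (liseikinX α ε N i + ε ^ ((1:ℝ)/2)) ^ (1 - 2*α)) ∧
    (∃ C : ℝ, 0 < C ∧
      ∀ ε : ℝ, 0 < ε → ε ≤ 1 → ∀ N : ℕ, 2 ≤ N → ∀ i : ℤ, 2 ≤ i → i ≤ N →
        liseikinH α ε N i - liseikinH α ε N (i-1)
          ≤ C * ((1:ℝ)/N) ^ 2 * (liseikinX α ε N i + ε ^ ((1:ℝ)/2)) ^ (1 - 2*α)) := by
  have key : ∀ ε : ℝ, 0 < ε → ∀ N : ℕ, 2 ≤ N → ∀ i : ℤ, 2 ≤ i →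
      liseikinH α ε N i - liseikinH α ε N (i-1)
        ≤ 2 * (1 - α) * (((1 + ε ^ ((1:ℝ)/2)) ^ α - ε ^ (α/2)) / α) ^ 2 * ((1:ℝ)/N) ^ 2
            * (liseikinX α ε N i + ε ^ ((1:ℝ)/2)) ^ (1 - 2*α) := by
    intro ε hε N hN i hi
    refine (liseikinH_sub_le hα0 hα1 hε (show 0 < N by lia) hi).trans ?_
    have hx := Real.rpow_nonneg
      (liseikinX_add_nonneg hα0 hε N (show 0 ≤ i by lia)) (1 - 2*α)
    gcongr
    linarith
  refine ⟨fun ε hε _ N hN i hi _ => key ε hε N hN i hi,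
    2 * (1 - α) * (2 / α) ^ 2, ?_, fun ε hε hε1 N hN i hi _ => (key ε hε N hN i hi).trans ?_⟩
  · have : 0 < 1 - α := by linarith
    positivity
  · have hx := Real.rpow_nonneg
      (liseikinX_add_nonneg hα0 hε N (show 0 ≤ i by lia)) (1 - 2*α)
    have hD := liseikin_slope_pos hα0 hε
    have hs : ε ^ ((1:ℝ)/2) ≤ 1 := Real.rpow_le_one hε.le hε1 (by norm_num)
    have hs0 : 0 < ε ^ ((1:ℝ)/2) := Real.rpow_pos_of_pos hε _
    have hc : 0 < ε ^ (α/2) := Real.rpow_pos_of_pos hε _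
    have hle : (1 + ε ^ ((1:ℝ)/2)) ^ α ≤ 1 + ε ^ ((1:ℝ)/2) :=
      Real.rpow_le_self_of_one_le (by linarith) (by linarith)
    have hα' : 0 ≤ 2 * (1 - α) := by linarith
    gcongr
    linarith
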